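/- Let s : ℕ → ℕ be a function such that for some fixed m > 0 and all t, s is superadditive along multiples of m in the sense arising from multiplication of sections (i.e., there is a graded ring structure making ⊕_t H^0 a graded ring). Suppose κ is the maximal dimension of the image of the rational maps defined by linear systems L ⊆ H^0(X, L^m): then there is α > 0 with α t^κ < h^0(X, L^{tm}) for all t ≫ 0. Concretely: if φ_L : X ⇢ P^N is a rational map with image of dimension κ_g, and H^0(φ_L(X), O(t)) embeds into H^0(X, L^{tm}) for all t > 0, then since the Hilbert polynomial of φ_L(X) has degree κ_g, there exists α > 0 with α t^{κ_g} < h^0(X, L^{tm}) for t ≫ 0. Hence κ_g(X, L) ≤ κ_a(X, L). -/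

import Mathlib

open MvPolynomial

theorem ringKrullDim_le_of_isIntegral (R S : Type*) [CommRing R] [CommRing S] [Algebra R S]
    [Algebra.IsIntegral R S] : ringKrullDim S ≤ ringKrullDim R :=
  Order.krullDim_le_of_strictMono (PrimeSpectrum.comap (algebraMap R S))
    fun _ _ hpq ↦ Ideal.IsIntegral.comap_lt_comap hpq

/-- The Krull dimension of a finitely generated algebra over a field is at most its
transcendence degree. -/
theorem natCast_le_trdeg_of_le_ringKrullDim {k A : Type*} [Field k] [CommRing A] [Nontrivial A]
    [Algebra k A] [Algebra.FiniteType k A] {n : ℕ} (hn : (n : WithBot ℕ∞) ≤ ringKrullDim A) :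
    (n : Cardinal) ≤ Algebra.trdeg k A := by
  obtain ⟨s, g, hinj, hint⟩ := exists_integral_inj_algHom_of_fg k A
  have hns : n ≤ s := by
    let := g.toRingHom.toAlgebra
    have : Algebra.IsIntegral (MvPolynomial (Fin s) k) A := ⟨hint⟩
    have := hn.trans (ringKrullDim_le_of_isIntegral (MvPolynomial (Fin s) k) A)
    rw [MvPolynomial.ringKrullDim_of_isNoetherianRing, ringKrullDim_eq_zero_of_field] at this
    simpa using this
  have hind : AlgebraicIndependent k (g ∘ X) := (algebraicIndependent_X (Fin s) k).map' hinj
  have hs := hind.lift_cardinalMk_le_trdeg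
  simp only [Cardinal.mk_fin, Cardinal.lift_natCast, Cardinal.lift_uzero] at hs
  exact (Nat.cast_le.mpr hns).trans hs

/-- Among the generators of an algebra over a field which is a domain, one finds as many
algebraically independent ones as the Krull dimension. -/
theorem exists_algebraicIndependent_comp_of_le_ringKrullDim {k A ι : Type*} [Field k] [CommRing A]
    [IsDomain A] [Algebra k A] [Finite ι] (x : ι → A) (hx : Algebra.adjoin k (Set.range x) = ⊤)
    {n : ℕ} (hn : (n : WithBot ℕ∞) ≤ ringKrullDim A) :
    ∃ a : Fin n → ι, AlgebraicIndependent k (x ∘ a) := by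
  have : Algebra.FiniteType k A :=
    ⟨Subalgebra.fg_def.mpr ⟨Set.range x, Set.finite_range x, hx⟩⟩
  have : Algebra.IsAlgebraic (Algebra.adjoin k (Set.range x)) A :=
    ⟨fun y ↦ isAlgebraic_algebraMap (⟨y, hx ▸ Algebra.mem_top⟩ : Algebra.adjoin k (Set.range x))⟩
  obtain ⟨t, htx, ht⟩ := exists_isTranscendenceBasis_subset (R := k) (Set.range x)
  have hcard : (n : Cardinal) ≤ Cardinal.mk t :=
    (natCast_le_trdeg_of_le_ringKrullDim (k := k) hn).trans ht.cardinalMk_eq_trdeg.ge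
  obtain ⟨e⟩ : Nonempty (Fin n ↪ t) := Cardinal.lift_mk_le'.mp (by simpa using hcard)
  choose a ha using fun i ↦ htx (e i).2
  refine ⟨a, ?_⟩
  have : x ∘ a = Subtype.val ∘ e := funext ha
  exact this ▸ ht.1.comp e e.injective

theorem finrank_homogeneousSubmodule (σ k : Type*) [Fintype σ] [Field k] (t : ℕ) :
    Module.finrank k (homogeneousSubmodule σ k t) = (Fintype.card σ).multichoose t := by
  classical
  have e : {d : σ →₀ ℕ | d.degree = t} = (Finset.univ.finsuppAntidiag t : Finset (σ →₀ ℕ)) := by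
    ext d
    simp [Finsupp.degree_eq_sum]
  rw [homogeneousSubmodule_eq_finsupp_supported, e,
    (AddMonoidAlgebra.supportedEquivFinsupp _).finrank_eq, Module.finrank_finsupp_self]
  simp [Finset.card_finsuppAntidiag_nat_eq_multichoose]

theorem Nat.pow_le_factorial_mul_multichoose_succ (n t : ℕ) :
    (t + 1) ^ n ≤ n.factorial * (n + 1).multichoose t := by
  have h := Nat.pow_succ_le_ascFactorial (t + 1) n
  rw [Nat.ascFactorial_eq_factorial_mul_choose] at h
  rw [Nat.multichoose_eq, show n + 1 + t - 1 = t + n by omega, Nat.choose_symm_add]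
  exact h

/-- Proposition 1.13 (`κ_g(X, L) ≤ κ_a(X, L)`), in the concrete form used in its proof.
Let `φ_L : X ⇢ ℙ^N` be the rational map attached to a subspace `L ⊆ H⁰(X, L^m)` whose image
`V = φ_L(X)` has dimension `κ`.  Model `V` by its homogeneous coordinate ring: a graded
integral quotient `k[x_0, …, x_N]/I` of Krull dimension `κ + 1`, whose degree-`t` piece
`H⁰(V, O(t)) ⊇ (k[x]/I)_t ≃ L^t` embeds into `H⁰(X, L^{tm})`; the latter dimension is
`h (t * m)`.  Since the Hilbert polynomial of `V` has degree `κ`, there is `α > 0` with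
`α t^κ < h⁰(X, L^{tm})` for all `t ≫ 0`; hence `κ_g(X, L) ≤ κ_a(X, L)`. -/
theorem stmt_10 (k : Type*) [Field k] (N κ : ℕ)
    (I : Ideal (MvPolynomial (Fin (N + 1)) k))
    (hIhom : ∀ f ∈ I, ∀ n : ℕ, (homogeneousComponent n f : MvPolynomial (Fin (N + 1)) k) ∈ I)
    [IsDomain (MvPolynomial (Fin (N + 1)) k ⧸ I)]
    (hdim : ringKrullDim (MvPolynomial (Fin (N + 1)) k ⧸ I) = (κ + 1 : ℕ))
    (m : ℕ) (hm : 0 < m) (h : ℕ → ℕ)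
    (hcomp : ∀ t : ℕ, 0 < t →
      Module.finrank k
        ((homogeneousSubmodule (Fin (N + 1)) k t).map
          (Ideal.Quotient.mkₐ k I).toLinearMap) ≤ h (t * m)) :
    ∃ α : ℝ, 0 < α ∧ ∀ᶠ t : ℕ in Filter.atTop, α * (t : ℝ) ^ κ < (h (t * m) : ℝ) := by
  let A := MvPolynomial (Fin (N + 1)) k ⧸ I
  let π : MvPolynomial (Fin (N + 1)) k →ₐ[k] A := Ideal.Quotient.mkₐ k I
  have hgen : Algebra.adjoin k (Set.range (π ∘ X)) = ⊤ := by
    rw [Set.range_comp, ← AlgHom.map_adjoin, adjoin_range_X, Algebra.map_top,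
      (AlgHom.range_eq_top π).mpr (Ideal.Quotient.mkₐ_surjective k I)]
  obtain ⟨a, ha⟩ := exists_algebraicIndependent_comp_of_le_ringKrullDim (π ∘ X) hgen hdim.ge
  have hrank (t : ℕ) : (κ + 1).multichoose t ≤
      Module.finrank k ((homogeneousSubmodule (Fin (N + 1)) k t).map π.toLinearMap) := by
    have : Module.Finite k (homogeneousSubmodule (Fin (N + 1)) k t) :=
      Module.Finite.iff_fg.mpr (homogeneousSubmodule_fg _ _ t)
    have hle : (homogeneousSubmodule (Fin (κ + 1)) k t).map (aeval ((π ∘ X) ∘ a)).toLinearMap ≤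
        (homogeneousSubmodule (Fin (N + 1)) k t).map π.toLinearMap := by
      rintro _ ⟨p, hp, rfl⟩
      refine ⟨rename a p, IsHomogeneous.rename_isHomogeneous hp, ?_⟩
      have : π.comp (rename a) = aeval ((π ∘ X) ∘ a) := by ext; simp
      exact DFunLike.congr_fun this p
    have := Submodule.finrank_mono hle
    rwa [← (Submodule.equivMapOfInjective (aeval ((π ∘ X) ∘ a)).toLinearMap ha _).finrank_eq,
      finrank_homogeneousSubmodule, Fintype.card_fin] at this
  refine ⟨1 / (2 * κ.factorial), by positivity, ?_⟩
  filter_upwards [Filter.eventually_gt_atTop 0] with t ht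
  have hpow : (t : ℝ) ^ κ ≤ κ.factorial * h (t * m) := by
    exact_mod_cast (Nat.pow_le_pow_left t.le_succ κ).trans
      ((Nat.pow_le_factorial_mul_multichoose_succ κ t).trans
        (Nat.mul_le_mul_left _ ((hrank t).trans (hcomp t ht))))
  have hpos : (0 : ℝ) < (t : ℝ) ^ κ := by positivity
  have hfac : (0 : ℝ) < κ.factorial := by positivity
  rw [one_div_mul_eq_div, div_lt_iff₀ (by positivity)]
  linarith
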